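/- Suppose χ₁ and χ₂ are quadratic and q₁, q₂ > 4 are odd. Let γ = (a, b; r·q₁q₂, d) ∈ Γ₀(q₁q₂) with r ≥ 1, and let γ' = (d, −r; −b·q₁q₂, a). Then there exists an integer z such that S_{χ₁,χ₂}(γ) = χ₁(−1) · S_{χ₂,χ₁}(γ') + 2z. -/

import Mathlib

open Complex Finset
open scoped Classical

/-- The sawtooth function `B₁(x)`: `0` if `x ∈ ℤ`, and `x - ⌊x⌋ - 1/2` otherwise. -/
noncomputable def sawtooth (x : ℝ) : ℝ :=
  if ∃ n : ℤ, (n : ℝ) = x then 0 else Int.fract x - 1 / 2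

/-- The newform Dedekind sum `S_{χ₁,χ₂}(a, c)` associated to Dirichlet characters
`χ₁ mod q₁` and `χ₂ mod q₂`. -/
noncomputable def newformDedekindSum {q₁ q₂ : ℕ} (χ₁ : DirichletCharacter ℂ q₁)
    (χ₂ : DirichletCharacter ℂ q₂) (a c : ℤ) : ℂ :=
  ∑ j ∈ Finset.range c.toNat, ∑ n ∈ Finset.range q₁,
    (starRingEnd ℂ) (χ₂ (j : ZMod q₂)) * (starRingEnd ℂ) (χ₁ (n : ZMod q₁)) *
      (sawtooth ((j : ℝ) / (c : ℝ)) : ℂ) *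
      (sawtooth ((n : ℝ) / (q₁ : ℝ) + (a : ℝ) * (j : ℝ) / (c : ℝ)) : ℂ)

/-- The newform Dedekind sum of a matrix `γ = (a, b; c, d) ∈ SL₂(ℤ)`:
it is `S_{χ₁,χ₂}(a, c)` if `c ≥ 1`, `S_{χ₁,χ₂}(-γ)` if `c ≤ -1`, and `0` if `c = 0`. -/
noncomputable def newformDedekindSumSL {q₁ q₂ : ℕ} (χ₁ : DirichletCharacter ℂ q₁)
    (χ₂ : DirichletCharacter ℂ q₂) (γ : Matrix.SpecialLinearGroup (Fin 2) ℤ) : ℂ :=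
  if γ.1 1 0 = 0 then 0
  else if 1 ≤ γ.1 1 0 then newformDedekindSum χ₁ χ₂ (γ.1 0 0) (γ.1 1 0)
  else newformDedekindSum χ₁ χ₂ (-(γ.1 0 0)) (-(γ.1 1 0))

/-- Membership in `Γ₀(N)`: the lower-left entry is divisible by `N`. -/
def InGamma0 (N : ℕ) (γ : Matrix.SpecialLinearGroup (Fin 2) ℤ) : Prop :=
  (N : ℤ) ∣ γ.1 1 0

/-- Membership in `Γ₁(N)`: lower-left entry divisible by `N` and both diagonal
entries congruent to `1` mod `N`. -/
def InGamma1 (N : ℕ) (γ : Matrix.SpecialLinearGroup (Fin 2) ℤ) : Prop :=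
  InGamma0 N γ ∧ (N : ℤ) ∣ (γ.1 0 0 - 1) ∧ (N : ℤ) ∣ (γ.1 1 1 - 1)

/-- `x` lies in the ring of integers `ℤ[χ₁,χ₂]` of the field `F_{χ₁,χ₂} ⊆ ℂ` generated
by the values of `χ₁` and `χ₂`: `x` lies in the subfield of `ℂ` generated by the values
of the characters and is integral over `ℤ`. -/
def InRingOfIntegers {q₁ q₂ : ℕ} (χ₁ : DirichletCharacter ℂ q₁)
    (χ₂ : DirichletCharacter ℂ q₂) (x : ℂ) : Prop :=
  x ∈ Subfield.closure (Set.range (χ₁ : ZMod q₁ → ℂ) ∪ Set.range (χ₂ : ZMod q₂ → ℂ)) ∧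
    IsIntegral ℤ x

theorem sawtooth_eq_zero {x : ℝ} (h : ∃ n : ℤ, (n : ℝ) = x) : sawtooth x = 0 := if_pos h

theorem sawtooth_eq_fract {x : ℝ} (h : ¬ ∃ n : ℤ, (n : ℝ) = x) :
    sawtooth x = Int.fract x - 1 / 2 := if_neg h

theorem sawtooth_add_int (x : ℝ) (m : ℤ) : sawtooth (x + m) = sawtooth x := by
  by_cases h : ∃ n : ℤ, (n : ℝ) = x
  · rw [sawtooth_eq_zero h, sawtooth_eq_zero]
    obtain ⟨n, rfl⟩ := h
    exact ⟨n + m, by push_cast; rfl⟩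
  · rw [sawtooth_eq_fract h, sawtooth_eq_fract, Int.fract_add_intCast]
    rintro ⟨n, hn⟩
    exact h ⟨n - m, by push_cast; linarith⟩

theorem sawtooth_neg (x : ℝ) : sawtooth (-x) = -sawtooth x := by
  by_cases h : ∃ n : ℤ, (n : ℝ) = x
  · rw [sawtooth_eq_zero h, sawtooth_eq_zero, neg_zero]
    obtain ⟨n, rfl⟩ := h
    exact ⟨-n, by push_cast; rfl⟩
  · have hf : Int.fract x ≠ 0 := fun h0 => h ⟨⌊x⌋, by
      have := Int.floor_add_fract x
      linarith⟩
    rw [sawtooth_eq_fract h, sawtooth_eq_fract, Int.fract_neg hf]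
    · ring
    · rintro ⟨n, hn⟩
      exact h ⟨-n, by push_cast; linarith⟩

/-- The defect of additivity of the sawtooth function is `±1/2` away from the integers. -/
theorem sawtooth_additive_defect_sq {u v : ℝ} (hu : ¬ ∃ n : ℤ, (n : ℝ) = u)
    (hv : ¬ ∃ n : ℤ, (n : ℝ) = v) (huv : ¬ ∃ n : ℤ, (n : ℝ) = u + v) :
    (sawtooth u + sawtooth v - sawtooth (u + v)) ^ 2 = 1 / 4 := by
  rw [sawtooth_eq_fract hu, sawtooth_eq_fract hv, sawtooth_eq_fract huv]
  obtain ⟨z, hz⟩ := Int.fract_add u v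
  have h1 := Int.fract_nonneg u
  have h2 := Int.fract_nonneg v
  have h3 := Int.fract_nonneg (u + v)
  have h4 := Int.fract_lt_one u
  have h5 := Int.fract_lt_one v
  have h6 := Int.fract_lt_one (u + v)
  have h7 : z < 1 := by exact_mod_cast (by linarith : (z : ℝ) < 1)
  have h8 : -2 < z := by exact_mod_cast (by push_cast; linarith : ((-2 : ℤ) : ℝ) < z)
  have h9 : Int.fract u + Int.fract v - Int.fract (u + v) = -z := by linarith
  have h10 : Int.fract u - 1 / 2 + (Int.fract v - 1 / 2) - (Int.fract (u + v) - 1 / 2)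
      = -z - 1 / 2 := by linarith
  rw [h10]
  obtain rfl | rfl : z = 0 ∨ z = -1 := by omega
  · norm_num
  · norm_num

/-- Summing a function of period `N` over an affine reparametrization of the residues mod `N`. -/
theorem sum_range_affine_of_periodic {M : Type*} [AddCommMonoid M] {N : ℕ} (hN : 0 < N)
    {g : ℤ → M} (hg : ∀ x k : ℤ, g (x + N * k) = g x) {u : ℤ} (hu : IsCoprime u N) (s : ℤ) :
    ∑ j ∈ range N, g (u * j + s) = ∑ j ∈ range N, g j := by
  have hN' : (0 : ℤ) < N := by exact_mod_cast hN
  have hmod (x : ℤ) : (((x % N).toNat : ℕ) : ℤ) = x % N :=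
    Int.toNat_of_nonneg (Int.emod_nonneg _ hN'.ne')
  have hmaps : ∀ j ∈ range N, ((u * (j : ℤ) + s) % N).toNat ∈ range N := fun j _ => by
    rw [mem_range]
    have := Int.emod_lt_of_pos (u * (j : ℤ) + s) hN'
    have := hmod (u * (j : ℤ) + s)
    omega
  have hinj : Set.InjOn (fun j : ℕ => ((u * (j : ℤ) + s) % N).toNat) (range N) := by
    intro i hi j hj hij
    have h1 : (u * (i : ℤ) + s) % N = (u * (j : ℤ) + s) % N := by
      rw [← hmod, ← hmod (u * (j : ℤ) + s)]
      exact congrArg (Nat.cast : ℕ → ℤ) hij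
    have h2 : (N : ℤ) ∣ (i - j) * u := by
      have := Int.ModEq.dvd h1.symm
      convert this using 1
      ring
    have h3 : (N : ℤ) ∣ i - j := hu.symm.dvd_of_dvd_mul_right h2
    have h4 : i ≡ j [MOD N] := (Int.natCast_modEq_iff.1 (Int.modEq_iff_dvd.2 h3)).symm
    exact Nat.ModEq.eq_of_lt_of_lt h4 (by simpa using hi) (by simpa using hj)
  refine sum_bij (fun j _ => ((u * (j : ℤ) + s) % N).toNat) hmaps
    (fun i hi j hj h => hinj (by simpa using hi) (by simpa using hj) h)
    (fun b hb => ?_) (fun j _ => ?_)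
  · have := Finset.surjOn_of_injOn_of_card_le _ hmaps hinj le_rfl
    obtain ⟨j, hj, h⟩ := this (by simpa using hb)
    exact ⟨j, by simpa using hj, h⟩
  · rw [hmod, ← hg ((u * (j : ℤ) + s) % N) ((u * (j : ℤ) + s) / N), Int.emod_add_mul_ediv]

theorem sum_range_mul_eq {M : Type*} [AddCommMonoid M] (m k : ℕ) (g : ℕ → M) :
    ∑ j ∈ range (m * k), g j = ∑ l ∈ range m, ∑ i ∈ range k, g (l + m * i) := by
  rw [sum_comm]
  induction k with
  | zero => simp
  | succ k ih =>
    rw [sum_range_succ, ← ih, Nat.mul_succ, sum_range_add]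
    simp only [add_comm]

/-- The distribution relation of the sawtooth function. -/
theorem sum_sawtooth_add_div {N : ℕ} (hN : 0 < N) (t : ℝ) :
    ∑ k ∈ range N, sawtooth (t + k / N) = sawtooth (N * t) := by
  have hN' : (0 : ℝ) < N := by exact_mod_cast hN
  set s : ℝ := Int.fract (N * t) / N with hs
  have hs0 : 0 ≤ s := div_nonneg (Int.fract_nonneg _) hN'.le
  have hs1 : N * s < 1 := by
    rw [hs, mul_div_cancel₀ _ hN'.ne']
    exact Int.fract_lt_one _
  have ht : t = s + (⌊N * t⌋ : ℤ) / N := by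
    rw [hs, ← add_div, add_comm, Int.floor_add_fract, mul_div_cancel_left₀ _ hN'.ne']
  have hper : ∀ x k : ℤ, sawtooth (s + ((x + N * k : ℤ) : ℝ) / N) = sawtooth (s + x / N) := by
    intro x k
    rw [← sawtooth_add_int (s + x / N) k]
    congr 1
    push_cast
    field_simp
    ring
  have h1 : ∑ k ∈ range N, sawtooth (t + k / N) = ∑ k ∈ range N, sawtooth (s + k / N) := by
    have := sum_range_affine_of_periodic hN (g := fun x : ℤ => sawtooth (s + x / N)) hper
      (u := 1) isCoprime_one_left ⌊N * t⌋
    calc _ = _ := ?_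
      _ = _ := this
      _ = _ := by simp
    refine sum_congr rfl fun k _ => ?_
    congr 1
    push_cast
    conv_lhs => rw [ht]
    ring
  have h2 : sawtooth (N * t) = sawtooth (N * s) := by
    rw [← sawtooth_add_int (N * s) ⌊N * t⌋]
    congr 1
    conv_lhs => rw [ht]
    field_simp
  have hsum : ∑ k ∈ range N, ((k : ℝ) / N - 1 / 2) = -(1 / 2) := by
    have h3 : ∀ n : ℕ, ∑ k ∈ range n, (k : ℝ) = n * (n - 1) / 2 := fun n => by
      induction n with
      | zero => simp
      | succ n ih => rw [sum_range_succ, ih]; push_cast; ring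
    rw [sum_sub_distrib, ← sum_div, h3]
    simp
    field_simp
    ring
  rw [h1, h2]
  have hlt (k : ℕ) (hk : k ∈ range N) : s + k / N < 1 := by
    have : (k : ℝ) + 1 ≤ N := by exact_mod_cast mem_range.1 hk
    have : N * (s + k / N) < N * 1 := by
      rw [mul_add, show (N : ℝ) * (k / N) = k by field_simp]
      linarith
    exact lt_of_mul_lt_mul_left this hN'.le
  have hfract {x : ℝ} (hx0 : 0 < x) (hx1 : x < 1) : sawtooth x = x - 1 / 2 := by
    rw [sawtooth_eq_fract, Int.fract_eq_self.2 ⟨hx0.le, hx1⟩]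
    rintro ⟨n, rfl⟩
    have h1 : 0 < n := by exact_mod_cast hx0
    have h2 : n < 1 := by exact_mod_cast hx1
    omega
  rcases hs0.eq_or_lt with h0 | h0
  · rw [← h0, mul_zero, sawtooth_eq_zero ⟨0, by simp⟩]
    obtain ⟨M, rfl⟩ : ∃ M, N = M + 1 := ⟨N - 1, by omega⟩
    rw [sum_range_succ'] at hsum ⊢
    rw [sawtooth_eq_zero (x := 0 + ((0 : ℕ) : ℝ) / ((M + 1 : ℕ) : ℝ)) ⟨0, by simp⟩, add_zero]
    rw [sum_congr rfl (g := fun k : ℕ => ((k + 1 : ℕ) : ℝ) / ((M + 1 : ℕ) : ℝ) - 1 / 2)]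
    · simp only [Nat.cast_zero, zero_div] at hsum
      linarith
    · intro k hk
      have := hlt (k + 1) (by simpa using hk)
      rw [← h0, zero_add] at this
      rw [zero_add, hfract (by positivity) this]
  · rw [hfract (x := N * s) (by positivity) hs1,
      sum_congr rfl (g := fun k : ℕ => s + ((k : ℝ) / N - 1 / 2))]
    · rw [sum_add_distrib, hsum]
      simp
      ring
    · intro k hk
      rw [hfract (by positivity) (hlt k hk)]
      ring

section QuadraticCharacter

variable {q : ℕ} {χ : DirichletCharacter ℂ q}

theorem apply_sq_of_sq_eq_one (hχ : χ ^ 2 = 1) {x : ZMod q} (hx : IsUnit x) : χ x ^ 2 = 1 := by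
  rw [← MulChar.pow_apply' χ two_ne_zero, hχ, MulChar.one_apply hx]

theorem exists_int_of_sq_eq_one (hχ : χ ^ 2 = 1) (x : ZMod q) :
    ∃ e : ℤ, χ x = e ∧ (IsUnit x → e = 1 ∨ e = -1) := by
  by_cases hx : IsUnit x
  · rcases mul_self_eq_one_iff.1 ((sq _).symm.trans (apply_sq_of_sq_eq_one hχ hx)) with h | h
    · exact ⟨1, by simp [h], fun _ => Or.inl rfl⟩
    · exact ⟨-1, by simp [h], fun _ => Or.inr rfl⟩
  · exact ⟨0, by simp [χ.map_nonunit hx], fun h => absurd h hx⟩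

theorem conj_apply_of_sq_eq_one (hχ : χ ^ 2 = 1) (x : ZMod q) :
    (starRingEnd ℂ) (χ x) = χ x := by
  obtain ⟨e, he, -⟩ := exists_int_of_sq_eq_one hχ x
  rw [he, map_intCast]

theorem isUnit_intCast_of_isCoprime {u : ℤ} (hu : IsCoprime u q) : IsUnit (u : ZMod q) :=
  (ZMod.coe_int_isUnit_iff_isCoprime u q).2 hu.symm

theorem sum_range_eq_zero_of_ne_one (hq : 0 < q) (hχ : χ ≠ 1) :
    ∑ n ∈ range q, χ (n : ZMod q) = 0 := by
  have : NeZero q := ⟨hq.ne'⟩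
  rw [← MulChar.sum_eq_zero_of_ne_one hχ]
  refine sum_bij (fun n _ => (n : ZMod q)) (fun _ _ => mem_univ _) (fun i hi j hj h => ?_)
    (fun b _ => ⟨b.val, by simpa using ZMod.val_lt b, by simp⟩) fun _ _ => rfl
  exact Nat.ModEq.eq_of_lt_of_lt ((ZMod.natCast_eq_natCast_iff _ _ _).1 h)
    (by simpa using hi) (by simpa using hj)

/-- The sawtooth function twisted by the additive shifts `n / q`, weighted by `χ n`. -/
noncomputable def twistedSawtooth (χ : DirichletCharacter ℂ q) (x : ℝ) : ℂ :=
  ∑ n ∈ range q, χ (n : ZMod q) * (sawtooth (x + n / q) : ℂ)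

theorem twistedSawtooth_add_int (x : ℝ) (m : ℤ) :
    twistedSawtooth χ (x + m) = twistedSawtooth χ x := by
  refine sum_congr rfl fun n _ => ?_
  rw [add_right_comm, sawtooth_add_int]

theorem sum_range_unit_mul (hq : 0 < q) (hχ : χ ^ 2 = 1) {u : ℤ} (hu : IsCoprime u q)
    {g : ℤ → ℂ} (hg : ∀ x k : ℤ, g (x + q * k) = g x) :
    ∑ n ∈ range q, χ (n : ZMod q) * g (u * n) =
      χ (u : ZMod q) * ∑ n ∈ range q, χ (n : ZMod q) * g n := by
  have := sum_range_affine_of_periodic hq (g := fun x : ℤ => χ (x : ZMod q) * g x)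
    (fun x k => by simp [hg]) hu 0
  simp only [Int.cast_natCast, add_zero] at this
  rw [← this, mul_sum]
  refine sum_congr rfl fun n _ => ?_
  have h := apply_sq_of_sq_eq_one hχ (isUnit_intCast_of_isCoprime hu)
  push_cast
  rw [map_mul]
  linear_combination (-(χ (n : ZMod q) * g (u * n))) * h

theorem sum_sawtooth_unit_mul (hq : 0 < q) (hχ : χ ^ 2 = 1) {u : ℤ} (hu : IsCoprime u q)
    (x : ℝ) : ∑ n ∈ range q, χ (n : ZMod q) * (sawtooth (x + u * n / q) : ℂ) =
      χ (u : ZMod q) * twistedSawtooth χ x := by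
  have hq' : (q : ℝ) ≠ 0 := by exact_mod_cast hq.ne'
  have := sum_range_unit_mul hq hχ hu (g := fun m : ℤ => (sawtooth (x + m / q) : ℂ))
    fun m k => by
      rw [← sawtooth_add_int (x + m / q) k]
      congr 2
      push_cast
      field_simp
      ring
  simpa [twistedSawtooth] using this

theorem twistedSawtooth_neg (hq : 0 < q) (hχ : χ ^ 2 = 1) (x : ℝ) :
    twistedSawtooth χ (-x) = -(χ (-1) * twistedSawtooth χ x) := by
  have := sum_sawtooth_unit_mul hq hχ (u := -1) (isCoprime_one_left.neg_left) x
  push_cast at this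
  rw [← this, twistedSawtooth, ← sum_neg_distrib]
  refine sum_congr rfl fun n _ => ?_
  rw [← mul_neg, ← Complex.ofReal_neg, ← sawtooth_neg]
  congr 3
  ring

/-- Distribution relation for the twisted sawtooth function. -/
theorem sum_range_mul_sawtooth (hq : 0 < q) {k : ℕ} (hk : 0 < k) (t : ℝ) :
    ∑ j ∈ range (q * k), χ (j : ZMod q) * (sawtooth (t + j / (q * k : ℕ)) : ℂ) =
      twistedSawtooth χ (k * t) := by
  have hq' : (q : ℝ) ≠ 0 := by exact_mod_cast hq.ne'
  have hk' : (k : ℝ) ≠ 0 := by exact_mod_cast hk.ne'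
  rw [sum_range_mul_eq]
  refine sum_congr rfl fun m _ => ?_
  rw [show (k : ℝ) * t + m / q = k * (t + m / (q * k)) by field_simp,
    ← sum_sawtooth_add_div hk, Complex.ofReal_sum, mul_sum]
  refine sum_congr rfl fun i _ => ?_
  congr 2
  · simp
  · congr 1
    push_cast
    field_simp
    ring

theorem isCoprime_of_apply_ne_zero {n : ℕ} (h : χ (n : ZMod q) ≠ 0) : IsCoprime (n : ℤ) q :=
  (χ.apply_ne_zero_iff n).1 (by simpa using h)

/-- For an odd modulus `q > 4` and a primitive quadratic character, the generalized
Bernoulli number `B_{1,χ}` is an integer. -/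
theorem twistedSawtooth_zero_mem_int (h4 : 4 < q) (hodd : Odd q) (hχ : χ ^ 2 = 1) (h1 : χ ≠ 1)
    (hp : χ.IsPrimitive) : ∃ m : ℤ, twistedSawtooth χ 0 = m := by
  have : NeZero q := ⟨by omega⟩
  have hq : 0 < q := by omega
  choose e he hunit using exists_int_of_sq_eq_one hχ
  set M : ℤ := ∑ n ∈ range q, e n * n with hM
  have hqC : (q : ℂ) ≠ 0 := by exact_mod_cast hq.ne'
  have hval : twistedSawtooth χ 0 = M / q := by
    have h0 : ∑ n ∈ range q, χ (n : ZMod q) * ((1 : ℂ) / 2) = 0 := by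
      rw [← sum_mul, sum_range_eq_zero_of_ne_one hq h1, zero_mul]
    rw [← sub_zero ((M : ℂ) / q), ← h0, hM, Int.cast_sum, sum_div, ← sum_sub_distrib]
    refine sum_congr rfl fun n hn => ?_
    by_cases hn0 : n = 0
    · subst hn0
      have : χ ((0 : ℕ) : ZMod q) = 0 := by
        simpa using DirichletCharacter.map_zero' χ (by omega)
      rw [this]
      simp
    · have hnq : n < q := mem_range.1 hn
      have hq' : (0 : ℝ) < q := by exact_mod_cast hq
      have hpos : (0 : ℝ) < n / q := div_pos (by exact_mod_cast Nat.pos_of_ne_zero hn0) hq'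
      have hlt : (n : ℝ) / q < 1 := (div_lt_one hq').2 (by exact_mod_cast hnq)
      rw [zero_add, sawtooth_eq_fract, Int.fract_eq_self.2 ⟨hpos.le, hlt⟩]
      · rw [he]
        push_cast
        ring
      · rintro ⟨m, hm⟩
        rw [← hm] at hpos hlt
        have h2 : 0 < m := by exact_mod_cast hpos
        have h3 : m < 1 := by exact_mod_cast hlt
        omega
  have hmulM : ∀ u : ℤ, IsCoprime u q → (q : ℤ) ∣ (e u * u - 1) * M := by
    intro u hu
    have hmul (x y : ZMod q) : e (x * y) = e x * e y := by
      have : (e (x * y) : ℂ) = e x * e y := by rw [← he, ← he, ← he, map_mul]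
      exact_mod_cast this
    have := sum_range_affine_of_periodic hq
      (g := fun x : ℤ => (e (x : ZMod q) : ZMod q) * (x : ZMod q)) (fun x k => by simp) hu 0
    rw [← ZMod.intCast_zmod_eq_zero_iff_dvd, hM]
    push_cast
    rw [sub_mul, one_mul, sub_eq_zero]
    simp only [Int.cast_natCast, add_zero, Int.cast_mul] at this
    rw [mul_sum]
    refine (sum_congr rfl fun n _ => ?_).trans this
    rw [hmul]
    push_cast
    ring
  have h3 : (q : ℤ) ∣ 3 * M := by
    have h2 : IsCoprime (2 : ℤ) q := by
      have := (Nat.coprime_two_left.2 hodd)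
      exact_mod_cast Nat.isCoprime_iff_coprime.2 this
    have hd := hmulM 2 h2
    rcases hunit _ (isUnit_intCast_of_isCoprime h2) with h | h
    · rw [h] at hd
      exact Dvd.dvd.mul_left (by simpa using hd) 3
    · rw [h] at hd
      rwa [← dvd_neg, show -(3 * M) = (-1 * 2 - 1) * M by ring]
  obtain ⟨u, hu, hu3⟩ : ∃ u : ℤ, IsCoprime u q ∧ IsCoprime (e u * u - 1) 3 := by
    by_contra! hcon
    have hall : ∀ u : ℤ, IsCoprime u q → (3 : ℤ) ∣ e u * u - 1 := fun u hu => by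
      by_contra hdvd
      exact hcon u hu ((Int.prime_three.coprime_iff_not_dvd).2 hdvd).symm
    have hq3 : 3 ∣ q := by
      by_contra hdvd
      have h3q : IsCoprime (3 : ℤ) q := by
        exact_mod_cast Nat.isCoprime_iff_coprime.2
          ((Nat.Prime.coprime_iff_not_dvd Nat.prime_three).2 hdvd)
      have := hall 3 h3q
      omega
    have hfac : χ.FactorsThrough 3 := by
      rw [DirichletCharacter.factorsThrough_iff_ker_unitsMap hq3]
      intro x hx
      rw [MonoidHom.mem_ker] at hx ⊢
      have hcast : (((x : ZMod q).val : ℤ) : ZMod q) = x := by simp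
      have hxc : IsCoprime ((x : ZMod q).val : ℤ) q :=
        (Nat.isCoprime_iff_coprime.2 (ZMod.val_coe_unit_coprime x))
      have hx1 : (3 : ℤ) ∣ ((x : ZMod q).val : ℤ) - 1 := by
        have := congrArg (Units.val) hx
        rw [ZMod.unitsMap_val, ZMod.cast_eq_val] at this
        have h5 : ((((x : ZMod q).val : ℤ) - 1 : ℤ) : ZMod 3) = 0 := by
          push_cast
          rw [this]
          simp
        exact (ZMod.intCast_zmod_eq_zero_iff_dvd _ 3).1 h5
      have hx2 := hall _ hxc
      rw [hcast] at hx2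
      have hex : e (x : ZMod q) = 1 := by
        rcases hunit _ x.isUnit with h | h
        · exact h
        · rw [h] at hx2
          omega
      ext
      simp [he, hex]
    have h5 : χ.conductor ≤ 3 := Nat.sInf_le hfac
    rw [(DirichletCharacter.isPrimitive_def χ).1 hp] at h5
    omega
  have hqM : (q : ℤ) ∣ M := by
    obtain ⟨s, t, hst⟩ := hu3
    have h6 : M = s * ((e u * u - 1) * M) + t * (3 * M) := by linear_combination -M * hst
    rw [h6]
    exact dvd_add (Dvd.dvd.mul_left (hmulM u hu) s) (Dvd.dvd.mul_left h3 t)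
  obtain ⟨m, hm⟩ := hqM
  refine ⟨m, ?_⟩
  rw [hval, hm]
  push_cast
  field_simp

end QuadraticCharacter

section NewformDedekindSum

variable {q₁ q₂ : ℕ} {χ₁ : DirichletCharacter ℂ q₁} {χ₂ : DirichletCharacter ℂ q₂}

theorem newformDedekindSum_eq_sum_twistedSawtooth (hχ₁ : χ₁ ^ 2 = 1) (hχ₂ : χ₂ ^ 2 = 1) (a : ℤ)
    (c : ℕ) : newformDedekindSum χ₁ χ₂ a c = ∑ j ∈ range c,
      χ₂ (j : ZMod q₂) * (sawtooth (j / c) : ℂ) * twistedSawtooth χ₁ (a * j / c) := by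
  simp only [newformDedekindSum, twistedSawtooth, mul_sum, conj_apply_of_sq_eq_one hχ₁,
    conj_apply_of_sq_eq_one hχ₂, Int.toNat_natCast, Int.cast_natCast]
  refine sum_congr rfl fun j _ => sum_congr rfl fun n _ => ?_
  rw [add_comm ((n : ℝ) / q₁)]
  ring

theorem newformDedekindSum_neg_left (hq₁ : 0 < q₁) (hχ₁ : χ₁ ^ 2 = 1) (hχ₂ : χ₂ ^ 2 = 1) (a : ℤ)
    (c : ℕ) : newformDedekindSum χ₁ χ₂ (-a) c = -(χ₁ (-1) * newformDedekindSum χ₁ χ₂ a c) := by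
  simp only [newformDedekindSum_eq_sum_twistedSawtooth hχ₁ hχ₂]
  rw [mul_sum, ← sum_neg_distrib]
  refine sum_congr rfl fun j _ => ?_
  rw [show ((-a : ℤ) : ℝ) * j / c = -(a * j / c) by push_cast; ring, twistedSawtooth_neg hq₁ hχ₁]
  ring

/-- Replacing `a` by its inverse modulo the denominator. -/
theorem newformDedekindSum_inverse (hq₁ : 0 < q₁) (hq₂ : 0 < q₂) (hχ₁ : χ₁ ^ 2 = 1)
    (hχ₂ : χ₂ ^ 2 = 1) {r : ℕ} (hr : 0 < r) {a d m : ℤ}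
    (had : a * d = 1 + m * (q₂ * (r * q₁) : ℕ)) :
    newformDedekindSum χ₁ χ₂ d (q₂ * (r * q₁) : ℕ) =
      χ₁ (-1) * χ₁ (a : ZMod q₁) * χ₂ (a : ZMod q₂) *
        newformDedekindSum χ₁ χ₂ a (q₂ * (r * q₁) : ℕ) := by
  set c : ℕ := q₂ * (r * q₁) with hc
  have hc0 : 0 < c := by positivity
  have hcR : (c : ℝ) ≠ 0 := by exact_mod_cast hc0.ne'
  have hq₁R : (q₁ : ℝ) ≠ 0 := by exact_mod_cast hq₁.ne'
  have hcq₁ : (c : ℝ) = q₂ * (r * q₁) := by rw [hc]; push_cast; ring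
  have hac : IsCoprime a (c : ℤ) := ⟨d, -m, by linear_combination had⟩
  have haq₁ : IsCoprime a (q₁ : ℤ) :=
    hac.of_isCoprime_of_dvd_right (by rw [hc]; push_cast; exact ⟨q₂ * r, by ring⟩)
  have haR : (a : ℝ) * d = 1 + m * c := by exact_mod_cast had
  rw [newformDedekindSum_eq_sum_twistedSawtooth hχ₁ hχ₂,
    newformDedekindSum_eq_sum_twistedSawtooth hχ₁ hχ₂]
  have hstep : ∀ n : ℕ, ∑ j ∈ range c, χ₂ (j : ZMod q₂) * (sawtooth (j / c) : ℂ) *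
        (sawtooth (d * j / c + n / q₁) : ℂ) =
      ∑ j ∈ range c, χ₂ (a : ZMod q₂) * χ₂ (j : ZMod q₂) * (sawtooth (j / c) : ℂ) *
        (sawtooth (a * j / c + ((-a : ℤ) : ℝ) * n / q₁) : ℂ) := by
    intro n
    have := sum_range_affine_of_periodic hc0
      (g := fun j : ℤ => χ₂ (j : ZMod q₂) * (sawtooth (j / c) : ℂ) *
        (sawtooth (d * j / c + n / q₁) : ℂ)) (fun x k => by
        have h1 : ((c : ℕ) : ZMod q₂) = 0 := by rw [hc]; simp
        have h2 : sawtooth (((x + c * k : ℤ) : ℝ) / c) = sawtooth (x / c) := by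
          rw [← sawtooth_add_int (x / c) k]
          congr 1
          push_cast
          field_simp
        have h3 : sawtooth (d * ((x + c * k : ℤ) : ℝ) / c + n / q₁) =
            sawtooth (d * x / c + n / q₁) := by
          rw [← sawtooth_add_int (d * x / c + n / q₁) (d * k)]
          congr 1
          push_cast
          field_simp
          ring
        rw [h2, h3]
        simp [h1]) hac (-a * (r * q₂) * n)
    simp only [Int.cast_natCast] at this
    rw [← this]
    refine sum_congr rfl fun j _ => ?_
    have h1 : χ₂ ((a * j + -a * (r * q₂) * n : ℤ) : ZMod q₂) =
        χ₂ (a : ZMod q₂) * χ₂ (j : ZMod q₂) := by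
      rw [← map_mul]
      simp
    have h2 : ((a * j + -a * (r * q₂) * n : ℤ) : ℝ) / c =
        a * j / c + ((-a : ℤ) : ℝ) * n / q₁ := by
      rw [hcq₁] at hcR ⊢
      push_cast
      field_simp
    have h3 : sawtooth (d * ((a * j + -a * (r * q₂) * n : ℤ) : ℝ) / c + n / q₁) =
        sawtooth (j / c) := by
      rw [← sawtooth_add_int (j / c) (m * j - m * (r * q₂) * n), mul_div_assoc, h2]
      congr 1
      have h4 : (c : ℝ) / q₁ = q₂ * r := by rw [hcq₁]; field_simp
      have h5 : (c : ℝ) / c = 1 := div_self hcR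
      push_cast
      linear_combination (j / c - n / q₁ : ℝ) * haR - m * n * h4 + m * j * h5
    rw [h1, h2, h3]
    ring
  calc _ = ∑ n ∈ range q₁, χ₁ (n : ZMod q₁) * ∑ j ∈ range c, χ₂ (j : ZMod q₂) *
          (sawtooth (j / c) : ℂ) * (sawtooth (d * j / c + n / q₁) : ℂ) := by
        simp only [twistedSawtooth, mul_sum]
        rw [sum_comm]
        refine sum_congr rfl fun n _ => sum_congr rfl fun j _ => ?_
        ring
    _ = ∑ j ∈ range c, χ₂ (a : ZMod q₂) * χ₂ (j : ZMod q₂) * (sawtooth (j / c) : ℂ) *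
          ∑ n ∈ range q₁, χ₁ (n : ZMod q₁) *
            (sawtooth (a * j / c + ((-a : ℤ) : ℝ) * n / q₁) : ℂ) := by
        simp only [hstep, mul_sum]
        rw [sum_comm]
        refine sum_congr rfl fun n _ => sum_congr rfl fun j _ => ?_
        ring
    _ = _ := by
        rw [mul_sum]
        refine sum_congr rfl fun j _ => ?_
        rw [sum_sawtooth_unit_mul hq₁ hχ₁ haq₁.neg_left]
        push_cast
        rw [neg_eq_neg_one_mul, map_mul]
        ring

/-- Sums over `j mod c`, `n mod q₁` and `ν mod a` weighted by `χ₂ j * χ₁ n`. -/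
noncomputable def characterTripleSum (χ₁ : DirichletCharacter ℂ q₁) (χ₂ : DirichletCharacter ℂ q₂)
    (a c : ℕ) (G : ℕ → ℕ → ℕ → ℂ) : ℂ :=
  ∑ j ∈ range c, ∑ n ∈ range q₁, ∑ ν ∈ range a,
    χ₂ (j : ZMod q₂) * χ₁ (n : ZMod q₁) * G j n ν

theorem characterTripleSum_add (a c : ℕ) (G H : ℕ → ℕ → ℕ → ℂ) :
    characterTripleSum χ₁ χ₂ a c (fun j n ν => G j n ν + H j n ν) =
      characterTripleSum χ₁ χ₂ a c G + characterTripleSum χ₁ χ₂ a c H := by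
  simp only [characterTripleSum, mul_add, sum_add_distrib]

theorem characterTripleSum_const_mul (a c : ℕ) (k : ℂ) (G : ℕ → ℕ → ℕ → ℂ) :
    characterTripleSum χ₁ χ₂ a c (fun j n ν => k * G j n ν) =
      k * characterTripleSum χ₁ χ₂ a c G := by
  simp only [characterTripleSum, mul_sum, mul_left_comm k]

theorem characterTripleSum_eq_zero_of_independent_left (a c : ℕ)
    (hsum : ∑ j ∈ range c, χ₂ (j : ZMod q₂) = 0) (G : ℕ → ℕ → ℂ) :
    characterTripleSum χ₁ χ₂ a c (fun _ n ν => G n ν) = 0 := by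
  simp only [characterTripleSum, mul_assoc, ← mul_sum]
  rw [← sum_mul, hsum, zero_mul]

theorem characterTripleSum_eq_zero_of_independent_mid (a c : ℕ)
    (hsum : ∑ n ∈ range q₁, χ₁ (n : ZMod q₁) = 0) (G : ℕ → ℕ → ℂ) :
    characterTripleSum χ₁ χ₂ a c (fun j _ ν => G j ν) = 0 := by
  simp only [characterTripleSum, mul_assoc, ← mul_sum]
  refine sum_eq_zero fun j _ => ?_
  rw [← sum_mul, hsum, zero_mul, mul_zero]

theorem sum_range_mul_apply_eq_zero (hq₂ : 0 < q₂) (h₂ : χ₂ ≠ 1) (k : ℕ) :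
    ∑ j ∈ range (q₂ * k), χ₂ (j : ZMod q₂) = 0 := by
  rw [sum_range_mul_eq]
  simp [← mul_sum, sum_range_eq_zero_of_ne_one hq₂ h₂]

theorem sum_twistedSawtooth_distribution {a : ℕ} (ha : 0 < a) (hq₁ : 0 < q₁) (hχ₁ : χ₁ ^ 2 = 1)
    (haq₁ : IsCoprime (a : ℤ) q₁) (t : ℝ) :
    twistedSawtooth χ₁ (a * t) = χ₁ (a : ZMod q₁) *
      ∑ n ∈ range q₁, ∑ ν ∈ range a, χ₁ (n : ZMod q₁) * (sawtooth (t + (n / q₁ + ν / a)) : ℂ) := by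
  have h := sum_sawtooth_unit_mul hq₁ hχ₁ haq₁ (a * t)
  have h2 := apply_sq_of_sq_eq_one hχ₁ (isUnit_intCast_of_isCoprime haq₁)
  simp only [Int.cast_natCast] at h h2
  have h3 : ∑ n ∈ range q₁, ∑ ν ∈ range a,
      χ₁ (n : ZMod q₁) * (sawtooth (t + (n / q₁ + ν / a)) : ℂ) =
      χ₁ (a : ZMod q₁) * twistedSawtooth χ₁ (a * t) := by
    rw [← h]
    refine sum_congr rfl fun n _ => ?_
    rw [← mul_sum, ← Complex.ofReal_sum]
    simp only [← add_assoc]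
    rw [sum_sawtooth_add_div ha]
    congr 3
    ring
  rw [h3]
  linear_combination (-twistedSawtooth χ₁ (a * t)) * h2

/-- If a nonzero weight occurs, the arguments avoid the integers. -/
theorem not_exists_int_eq_div {c j : ℕ} (hc : 0 < c) (h1 : q₂ ≠ 1) (hdvd : q₂ ∣ c)
    (hcop : IsCoprime (j : ℤ) q₂) : ¬ ∃ m : ℤ, (m : ℝ) = j / c := by
  rintro ⟨m, hm⟩
  have hc' : (c : ℝ) ≠ 0 := by exact_mod_cast hc.ne'
  rw [eq_div_iff hc'] at hm
  have h2 : m * c = j := by exact_mod_cast hm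
  have h3 : (q₂ : ℤ) ∣ j := by
    rw [← h2]
    exact Dvd.dvd.mul_left (by exact_mod_cast hdvd) m
  have := hcop.isUnit_of_dvd' h3 dvd_rfl
  exact h1 (by simpa [Int.isUnit_iff_natAbs_eq] using this)

theorem not_exists_int_eq_div_add_div {a n ν : ℕ} (ha : 0 < a) (hq₁ : 0 < q₁) (h1 : q₁ ≠ 1)
    (haq₁ : IsCoprime (a : ℤ) q₁) (hcop : IsCoprime (n : ℤ) q₁) :
    ¬ ∃ m : ℤ, (m : ℝ) = n / q₁ + ν / a := by
  rintro ⟨m, hm⟩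
  have ha' : (a : ℝ) ≠ 0 := by exact_mod_cast ha.ne'
  have hq' : (q₁ : ℝ) ≠ 0 := by exact_mod_cast hq₁.ne'
  field_simp at hm
  have h2 : m * q₁ * a = n * a + q₁ * ν := by
    have : (m : ℝ) * q₁ * a = n * a + q₁ * ν := by linarith
    exact_mod_cast this
  have h3 : (q₁ : ℤ) ∣ n * a := ⟨m * a - ν, by linear_combination -h2⟩
  have := (hcop.mul_left haq₁).isUnit_of_dvd' h3 dvd_rfl
  exact h1 (by simpa [Int.isUnit_iff_natAbs_eq] using this)

/-- Reciprocity for newform Dedekind sums, with the complementary sum written in terms of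
twisted sawtooth functions at the points `ν / a`. -/
theorem newformDedekindSum_reciprocity (hq₁ : 0 < q₁) (hq₂ : 0 < q₂) (hχ₁ : χ₁ ^ 2 = 1)
    (hχ₂ : χ₂ ^ 2 = 1) (h₁ : χ₁ ≠ 1) (h₂ : χ₂ ≠ 1) {a r : ℕ} (ha : 0 < a) (hr : 0 < r)
    (haq₁ : IsCoprime (a : ℤ) q₁) (haq₂ : IsCoprime (a : ℤ) q₂) :
    newformDedekindSum χ₁ χ₂ a (q₂ * (r * q₁) : ℕ) =
      twistedSawtooth χ₁ 0 * twistedSawtooth χ₂ 0 - χ₁ (a : ZMod q₁) *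
        ∑ ν ∈ range a, twistedSawtooth χ₁ (ν / a) * twistedSawtooth χ₂ ((r * q₁ : ℕ) * (ν / a)) := by
  set c : ℕ := q₂ * (r * q₁) with hc
  have hc0 : 0 < c := by positivity
  have hcR : (c : ℝ) ≠ 0 := by exact_mod_cast hc0.ne'
  have haR : (a : ℝ) ≠ 0 := by exact_mod_cast ha.ne'
  have hq₁R : (q₁ : ℝ) ≠ 0 := by exact_mod_cast hq₁.ne'
  have hq₂R : (q₂ : ℝ) ≠ 0 := by exact_mod_cast hq₂.ne'
  have hrR : (r : ℝ) ≠ 0 := by exact_mod_cast hr.ne'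
  have hcq₁ : (c : ℝ) = q₂ * (r * q₁) := by rw [hc]; push_cast; ring
  have hq₁1 : q₁ ≠ 1 := fun h => h₁ (DirichletCharacter.level_one' χ₁ h)
  have hq₂1 : q₂ ≠ 1 := fun h => h₂ (DirichletCharacter.level_one' χ₂ h)
  have hsum₁ := sum_range_eq_zero_of_ne_one hq₁ h₁
  have hsum₂ : ∑ j ∈ range c, χ₂ (j : ZMod q₂) = 0 := sum_range_mul_apply_eq_zero hq₂ h₂ _
  let U : ℕ → ℝ := fun j => j / c
  let V : ℕ → ℕ → ℝ := fun n ν => n / q₁ + ν / a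
  have hUB : newformDedekindSum χ₁ χ₂ a c = χ₁ (a : ZMod q₁) * characterTripleSum χ₁ χ₂ a c
      (fun j n ν => (sawtooth (U j) : ℂ) * (sawtooth (U j + V n ν) : ℂ)) := by
    rw [newformDedekindSum_eq_sum_twistedSawtooth hχ₁ hχ₂, characterTripleSum, mul_sum]
    refine sum_congr rfl fun j _ => ?_
    rw [Int.cast_natCast, mul_div_assoc, sum_twistedSawtooth_distribution ha hq₁ hχ₁ haq₁,
      mul_left_comm, mul_sum]
    congr 1
    refine sum_congr rfl fun n _ => ?_
    rw [mul_sum]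
    refine sum_congr rfl fun ν _ => ?_
    ring
  have hVB : characterTripleSum χ₁ χ₂ a c
      (fun j n ν => (sawtooth (V n ν) : ℂ) * (sawtooth (U j + V n ν) : ℂ)) =
      ∑ ν ∈ range a, twistedSawtooth χ₁ (ν / a) *
        twistedSawtooth χ₂ ((r * q₁ : ℕ) * (ν / a)) := by
    simp only [characterTripleSum]
    rw [sum_comm]
    simp only [sum_comm (s := range c)]
    rw [sum_comm]
    refine sum_congr rfl fun ν _ => ?_
    rw [twistedSawtooth, sum_mul]
    refine sum_congr rfl fun n _ => ?_
    have h := sum_range_mul_sawtooth (χ := χ₂) hq₂ (k := r * q₁) (by positivity) (V n ν)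
    have h' : ((r * q₁ : ℕ) : ℝ) * V n ν =
        (r * q₁ : ℕ) * (ν / a) + ((r * n : ℤ) : ℝ) := by
      simp only [V]
      push_cast
      field_simp
      ring
    rw [h', twistedSawtooth_add_int] at h
    rw [← h, mul_sum]
    refine sum_congr rfl fun j _ => ?_
    rw [add_comm (U j), add_comm ((ν : ℝ) / a)]
    ring
  have hUV : χ₁ (a : ZMod q₁) * characterTripleSum χ₁ χ₂ a c
      (fun j n ν => (sawtooth (U j) : ℂ) * (sawtooth (V n ν) : ℂ)) =
      twistedSawtooth χ₁ 0 * twistedSawtooth χ₂ 0 := by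
    have h := sum_twistedSawtooth_distribution ha hq₁ hχ₁ haq₁ 0
    have h' := sum_range_mul_sawtooth (χ := χ₂) hq₂ (k := r * q₁) (by positivity) 0
    simp only [mul_zero, zero_add] at h h'
    rw [h, ← h', mul_assoc]
    congr 1
    rw [mul_comm, sum_mul, characterTripleSum]
    refine sum_congr rfl fun j _ => ?_
    simp only [mul_sum]
    refine sum_congr rfl fun n _ => sum_congr rfl fun ν _ => ?_
    ring
  have hUU : characterTripleSum χ₁ χ₂ a c (fun j _ _ => (sawtooth (U j) : ℂ) ^ 2) = 0 :=
    characterTripleSum_eq_zero_of_independent_mid a c hsum₁ fun j _ => (sawtooth (U j) : ℂ) ^ 2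
  have hVV : characterTripleSum χ₁ χ₂ a c (fun _ n ν => (sawtooth (V n ν) : ℂ) ^ 2) = 0 :=
    characterTripleSum_eq_zero_of_independent_left a c hsum₂ fun n ν => (sawtooth (V n ν) : ℂ) ^ 2
  have hconst : characterTripleSum χ₁ χ₂ a c (fun _ _ _ => (-(1 / 4) : ℂ)) = 0 :=
    characterTripleSum_eq_zero_of_independent_left a c hsum₂ fun _ _ => (-(1 / 4) : ℂ)
  have hBB : characterTripleSum χ₁ χ₂ a c (fun j n ν => (sawtooth (U j + V n ν) : ℂ) ^ 2) = 0 := by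
    rw [← characterTripleSum_eq_zero_of_independent_mid (χ₂ := χ₂) a c hsum₁
      fun j ν => (sawtooth (U j + ν / a) : ℂ) ^ 2]
    simp only [characterTripleSum]
    rw [sum_comm, sum_comm (s := range c) (t := range q₁)]
    refine sum_congr rfl fun n _ => ?_
    rw [sum_comm, sum_comm (s := range c)]
    refine sum_congr rfl fun ν _ => ?_
    have := sum_range_affine_of_periodic hc0 (u := 1)
      (g := fun j : ℤ => χ₂ (j : ZMod q₂) * χ₁ (n : ZMod q₁) *
        (sawtooth (j / c + ν / a) : ℂ) ^ 2) (fun x k => by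
        have h1 : ((c : ℕ) : ZMod q₂) = 0 := by rw [hc]; simp
        have h2 : sawtooth (((x + c * k : ℤ) : ℝ) / c + ν / a) = sawtooth (x / c + ν / a) := by
          rw [← sawtooth_add_int (x / c + ν / a) k]
          congr 1
          push_cast
          field_simp
          ring
        rw [h2]
        simp [h1]) isCoprime_one_left (q₂ * r * n)
    simp only [Int.cast_natCast] at this
    rw [← this]
    refine sum_congr rfl fun j _ => ?_
    congr 3
    · simp
    · congr 1
      simp only [U, V]
      rw [hcq₁]
      push_cast
      field_simp
      ring
  have hmain : characterTripleSum χ₁ χ₂ a c (fun j n ν =>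
        2 * ((sawtooth (U j) : ℂ) * (sawtooth (U j + V n ν) : ℂ) +
          (sawtooth (V n ν) : ℂ) * (sawtooth (U j + V n ν) : ℂ))) =
      characterTripleSum χ₁ χ₂ a c (fun j n ν =>
        2 * ((sawtooth (U j) : ℂ) * (sawtooth (V n ν) : ℂ)) +
          ((sawtooth (U j) : ℂ) ^ 2 + ((sawtooth (V n ν) : ℂ) ^ 2 +
            ((sawtooth (U j + V n ν) : ℂ) ^ 2 + (-(1 / 4) : ℂ))))) := by
    refine sum_congr rfl fun j _ => sum_congr rfl fun n _ => sum_congr rfl fun ν _ => ?_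
    by_cases hj : χ₂ (j : ZMod q₂) = 0
    · simp [hj]
    by_cases hn : χ₁ (n : ZMod q₁) = 0
    · simp [hn]
    have hj' := isCoprime_of_apply_ne_zero hj
    have hn' := isCoprime_of_apply_ne_zero hn
    have hU : ¬ ∃ m : ℤ, (m : ℝ) = U j := not_exists_int_eq_div hc0 hq₂1 (Dvd.intro _ rfl) hj'
    have hV : ¬ ∃ m : ℤ, (m : ℝ) = V n ν :=
      not_exists_int_eq_div_add_div ha hq₁ hq₁1 haq₁ hn'
    have hUV' : ¬ ∃ m : ℤ, (m : ℝ) = U j + V n ν := by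
      rintro ⟨m, hm⟩
      simp only [U, V] at hm
      rw [hcq₁] at hm
      refine not_exists_int_eq_div_add_div (ν := r * q₁ * ν) ha hq₂ hq₂1 haq₂ hj'
        ⟨m * (r * q₁) - r * n, ?_⟩
      push_cast
      rw [hm]
      field_simp
      ring
    have h := congrArg (fun x : ℝ => (x : ℂ)) (sawtooth_additive_defect_sq hU hV hUV')
    push_cast at h
    linear_combination (-(χ₂ (j : ZMod q₂) * χ₁ (n : ZMod q₁))) * h
  rw [characterTripleSum_const_mul, characterTripleSum_add, characterTripleSum_add,
    characterTripleSum_const_mul, characterTripleSum_add, characterTripleSum_add,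
    characterTripleSum_add, hUU, hVV, hBB, hconst, hVB] at hmain
  rw [hUB, ← hUV]
  linear_combination (χ₁ (a : ZMod q₁) / 2) * hmain

/-- The complementary sums attached to `r * q₁` and to its inverse up to sign modulo `a`. -/
theorem sum_twistedSawtooth_mul_reindex {a : ℕ} (ha : 0 < a) {u v m δ : ℤ}
    (huv : u * v = δ + m * a) (hδ : IsUnit δ) :
    ∑ ν ∈ range a, twistedSawtooth χ₂ (ν / a) * twistedSawtooth χ₁ (v * (ν / a)) =
      ∑ ν ∈ range a, twistedSawtooth χ₁ (δ * (ν / a)) * twistedSawtooth χ₂ (u * (ν / a)) := by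
  have haR : (a : ℝ) ≠ 0 := by exact_mod_cast ha.ne'
  have hu : IsCoprime u (a : ℤ) := by
    obtain ⟨w, rfl⟩ := hδ
    refine ⟨v * (w⁻¹ : ℤˣ), -m * (w⁻¹ : ℤˣ), ?_⟩
    have := w.mul_inv
    linear_combination ((w⁻¹ : ℤˣ) : ℤ) * huv + this
  have hper (χ : ∀ x : ℝ, ℂ) (hχ : ∀ (x : ℝ) (k : ℤ), χ (x + k) = χ x) (w x k : ℤ) :
      χ (w * (((x + a * k : ℤ) : ℝ) / a)) = χ (w * (x / a)) := by
    rw [← hχ (w * (x / a)) (w * k)]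
    congr 1
    push_cast
    field_simp
  have h := sum_range_affine_of_periodic ha
    (g := fun ν : ℤ => twistedSawtooth χ₂ (((1 : ℤ) : ℝ) * (ν / a)) *
      twistedSawtooth χ₁ (v * (ν / a)))
    (fun x k => by
      rw [hper _ twistedSawtooth_add_int, hper _ twistedSawtooth_add_int]) hu 0
  simp only [Int.cast_natCast, Int.cast_one, one_mul] at h
  rw [← h]
  refine sum_congr rfl fun ν _ => ?_
  have huvR : (u : ℝ) * v = δ + m * a := by exact_mod_cast huv
  have h1 : (v : ℝ) * (((u * ν + 0 : ℤ) : ℝ) / a) = δ * (ν / a) + ((m * ν : ℤ) : ℝ) := by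
    push_cast
    field_simp
    linear_combination (ν : ℝ) * huvR
  rw [h1, twistedSawtooth_add_int, mul_comm]
  congr 2
  push_cast
  ring

/-- The newform Dedekind sum of a matrix with left column `(a, c)`. -/
noncomputable def newformDedekindSumColumn (χ₁ : DirichletCharacter ℂ q₁)
    (χ₂ : DirichletCharacter ℂ q₂) (a c : ℤ) : ℂ :=
  if c = 0 then 0
  else if 1 ≤ c then newformDedekindSum χ₁ χ₂ a c
  else newformDedekindSum χ₁ χ₂ (-a) (-c)

theorem newformDedekindSumColumn_neg_left (hq₁ : 0 < q₁) (hχ₁ : χ₁ ^ 2 = 1) (hχ₂ : χ₂ ^ 2 = 1)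
    (a c : ℤ) : newformDedekindSumColumn χ₁ χ₂ (-a) c =
      -(χ₁ (-1) * newformDedekindSumColumn χ₁ χ₂ a c) := by
  unfold newformDedekindSumColumn
  split_ifs with h0 h1
  · simp
  · lift c to ℕ using by omega
    exact newformDedekindSum_neg_left hq₁ hχ₁ hχ₂ a c
  · obtain ⟨k, hk⟩ : ∃ k : ℕ, -c = k := ⟨(-c).toNat, by omega⟩
    rw [hk, newformDedekindSum_neg_left hq₁ hχ₁ hχ₂ (-a) k]

theorem apply_neg_one_eq_one_or_neg_one (hχ₁ : χ₁ ^ 2 = 1) : χ₁ (-1) = 1 ∨ χ₁ (-1) = -1 :=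
  mul_self_eq_one_iff.1
    ((sq _).symm.trans (apply_sq_of_sq_eq_one hχ₁ isUnit_one.neg))

theorem newformDedekindSum_reciprocity_mod_two_of_pos (h4₁ : 4 < q₁) (h4₂ : 4 < q₂)
    (hodd₁ : Odd q₁) (hodd₂ : Odd q₂) (hχ₁ : χ₁ ^ 2 = 1)
    (hχ₂ : χ₂ ^ 2 = 1) (h₁ : χ₁ ≠ 1) (h₂ : χ₂ ≠ 1) (hp₁ : χ₁.IsPrimitive) (hp₂ : χ₂.IsPrimitive)
    (hpar : χ₁ (-1) * χ₂ (-1) = 1) {a r : ℕ} (ha : 0 < a) (hr : 0 < r) {b d : ℤ}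
    (hdet : a * d - b * (r * (q₁ * q₂)) = 1) :
    ∃ z : ℤ, newformDedekindSum χ₁ χ₂ a (q₂ * (r * q₁) : ℕ) =
      χ₁ (-1) * newformDedekindSumColumn χ₂ χ₁ d (-b * (q₁ * q₂)) + 2 * (z : ℂ) := by
  have hq₁ : 0 < q₁ := by omega
  have hq₂ : 0 < q₂ := by omega
  have haq₁ : IsCoprime (a : ℤ) q₁ := ⟨d, -b * (r * q₂), by linear_combination hdet⟩
  have haq₂ : IsCoprime (a : ℤ) q₂ := ⟨d, -b * (r * q₁), by linear_combination hdet⟩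
  obtain ⟨m₁, hm₁⟩ := twistedSawtooth_zero_mem_int h4₁ hodd₁ hχ₁ h₁ hp₁
  obtain ⟨m₂, hm₂⟩ := twistedSawtooth_zero_mem_int h4₂ hodd₂ hχ₂ h₂ hp₂
  have ha₁ := apply_sq_of_sq_eq_one hχ₁ (isUnit_intCast_of_isCoprime haq₁)
  have ha₂ := apply_sq_of_sq_eq_one hχ₂ (isUnit_intCast_of_isCoprime haq₂)
  have hε₂ : χ₂ (-1) = χ₁ (-1) := by
    rcases apply_neg_one_eq_one_or_neg_one hχ₁ with h | h
    · rw [h] at hpar ⊢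
      linear_combination hpar
    · rw [h] at hpar ⊢
      linear_combination -hpar
  have hε : χ₁ (-1) ^ 2 = 1 := apply_sq_of_sq_eq_one hχ₁ isUnit_one.neg
  have hS₁ := newformDedekindSum_reciprocity hq₁ hq₂ hχ₁ hχ₂ h₁ h₂ ha hr haq₁ haq₂
  set T := ∑ ν ∈ range a, twistedSawtooth χ₁ (ν / a) *
    twistedSawtooth χ₂ ((r * q₁ : ℕ) * (ν / a)) with hT
  rw [hm₁, hm₂] at hS₁
  simp only [Int.cast_natCast] at ha₁ ha₂
  have hparity {x : ℂ} (hx : x ^ 2 = 1) : ∃ z : ℤ, (1 - x) * (m₁ * m₂) = 2 * (z : ℂ) := by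
    rcases mul_self_eq_one_iff.1 ((sq x).symm.trans hx) with h | h
    · exact ⟨0, by rw [h]; simp⟩
    · exact ⟨m₁ * m₂, by rw [h]; push_cast; ring⟩
  rcases lt_trichotomy b 0 with hb | rfl | hb
  · obtain ⟨k, rfl⟩ : ∃ k : ℕ, b = -k := ⟨(-b).toNat, by omega⟩
    have hk : 0 < k := by omega
    have hcol : newformDedekindSumColumn χ₂ χ₁ d (-(-(k : ℤ)) * (q₁ * q₂)) =
        newformDedekindSum χ₂ χ₁ d (q₁ * (k * q₂) : ℕ) := by
      have hc : -(-(k : ℤ)) * (q₁ * q₂) = (q₁ * (k * q₂) : ℕ) := by push_cast; ring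
      have hpos : 0 < q₁ * (k * q₂) := by positivity
      rw [hc, newformDedekindSumColumn, if_neg (by omega), if_pos (by omega)]
    have hinv := newformDedekindSum_inverse (χ₁ := χ₂) (χ₂ := χ₁) hq₂ hq₁ hχ₂ hχ₁ hk
      (a := a) (d := d) (m := -r) (by push_cast; linear_combination hdet)
    have hS₂ := newformDedekindSum_reciprocity hq₂ hq₁ hχ₂ hχ₁ h₂ h₁ ha hk haq₂ haq₁
    have hre := sum_twistedSawtooth_mul_reindex (χ₁ := χ₁) (χ₂ := χ₂) ha
      (u := (r * q₁ : ℕ)) (v := (k * q₂ : ℕ)) (m := -d) (δ := 1)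
      (by push_cast; linear_combination hdet) isUnit_one
    simp only [Int.cast_natCast, Int.cast_one, one_mul] at hre
    rw [hre, hm₁, hm₂, ← hT] at hS₂
    obtain ⟨z, hz⟩ := hparity (x := χ₁ (a : ZMod q₁) * χ₂ (a : ZMod q₂))
      (by rw [mul_pow, ha₁, ha₂, one_mul])
    refine ⟨z, ?_⟩
    simp only [Int.cast_natCast] at hinv
    rw [hcol, hinv, hS₁, hS₂, hε₂, ← hz]
    linear_combination (-(χ₁ (a : ZMod q₁) * χ₂ (a : ZMod q₂) *
      (m₂ * m₁ - χ₂ (a : ZMod q₂) * T))) * hε + (χ₁ (a : ZMod q₁) * T) * ha₂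
  · have hone : (a : ℤ) = 1 := by
      have : (a : ℤ) ∣ 1 := ⟨d, by linear_combination -hdet⟩
      exact Int.eq_one_of_dvd_one (by omega) this
    obtain rfl : a = 1 := by exact_mod_cast hone
    refine ⟨0, ?_⟩
    simp only [range_one, sum_singleton, Nat.cast_zero, zero_div, mul_zero, hm₁, hm₂] at hT
    rw [hS₁, hT]
    simp [newformDedekindSumColumn]
  · obtain ⟨k, rfl⟩ : ∃ k : ℕ, b = k := ⟨b.toNat, by omega⟩
    have hk : 0 < k := by omega
    have hcol : newformDedekindSumColumn χ₂ χ₁ d (-(k : ℤ) * (q₁ * q₂)) =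
        newformDedekindSum χ₂ χ₁ (-d) (q₁ * (k * q₂) : ℕ) := by
      have hc : -(k : ℤ) * (q₁ * q₂) = -((q₁ * (k * q₂) : ℕ) : ℤ) := by push_cast; ring
      have hpos : 0 < q₁ * (k * q₂) := by positivity
      rw [hc, newformDedekindSumColumn, if_neg (by omega), if_neg (by omega), neg_neg]
    have hinv := newformDedekindSum_inverse (χ₁ := χ₂) (χ₂ := χ₁) hq₂ hq₁ hχ₂ hχ₁ hk
      (a := a) (d := d) (m := r) (by push_cast; linear_combination hdet)
    have hS₂ := newformDedekindSum_reciprocity hq₂ hq₁ hχ₂ hχ₁ h₂ h₁ ha hk haq₂ haq₁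
    have hre := sum_twistedSawtooth_mul_reindex (χ₁ := χ₁) (χ₂ := χ₂) ha
      (u := (r * q₁ : ℕ)) (v := (k * q₂ : ℕ)) (m := d) (δ := -1)
      (by push_cast; linear_combination -hdet) isUnit_one.neg
    simp only [Int.cast_natCast, Int.cast_neg, Int.cast_one, neg_mul, one_mul,
      twistedSawtooth_neg hq₁ hχ₁, sum_neg_distrib, mul_assoc, ← mul_sum] at hre
    rw [hre, hm₁, hm₂, ← hT] at hS₂
    obtain ⟨z, hz⟩ := hparity (x := -(χ₁ (-1) * (χ₁ (a : ZMod q₁) * χ₂ (a : ZMod q₂))))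
      (by rw [neg_sq, mul_pow, mul_pow, ha₁, ha₂, hε, one_mul, one_mul])
    refine ⟨z, ?_⟩
    simp only [Int.cast_natCast] at hinv
    rw [hcol, newformDedekindSum_neg_left hq₂ hχ₂ hχ₁, hinv, hS₁, hS₂, hε₂, ← hz]
    linear_combination (χ₁ (-1) * χ₁ (a : ZMod q₁) * χ₂ (a : ZMod q₂) * m₁ * m₂ +
      χ₁ (a : ZMod q₁) * T * (χ₁ (-1) ^ 2 + 1) * χ₂ (a : ZMod q₂) ^ 2) * hε +
      (χ₁ (a : ZMod q₁) * T) * ha₂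

end NewformDedekindSum

theorem newform_dedekind_sum_reciprocity_gamma0_mod_two {q₁ q₂ : ℕ} (hq₁ : 0 < q₁) (hq₂ : 0 < q₂)
    (χ₁ : DirichletCharacter ℂ q₁) (χ₂ : DirichletCharacter ℂ q₂)
    (hχ₁ : χ₁ ≠ 1) (hχ₂ : χ₂ ≠ 1) (hp₁ : χ₁.IsPrimitive) (hp₂ : χ₂.IsPrimitive)
    (hpar : χ₁ (-1) * χ₂ (-1) = 1)
    (hquad₁ : χ₁ ^ 2 = 1) (hquad₂ : χ₂ ^ 2 = 1)
    (hodd₁ : Odd q₁) (hodd₂ : Odd q₂) (h4₁ : 4 < q₁) (h4₂ : 4 < q₂)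
    (γ γ' : Matrix.SpecialLinearGroup (Fin 2) ℤ) (hγ : InGamma0 (q₁ * q₂) γ)
    (r : ℤ) (hr : 1 ≤ r) (hc : γ.1 1 0 = r * ((q₁ : ℤ) * (q₂ : ℤ)))
    (h'a : γ'.1 0 0 = γ.1 1 1) (h'b : γ'.1 0 1 = -r)
    (h'c : γ'.1 1 0 = -(γ.1 0 1) * ((q₁ : ℤ) * (q₂ : ℤ))) (h'd : γ'.1 1 1 = γ.1 0 0) :
    ∃ z : ℤ, newformDedekindSumSL χ₁ χ₂ γ =
      χ₁ (-1) * newformDedekindSumSL χ₂ χ₁ γ' + 2 * (z : ℂ) := by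
  have hdet := γ.2
  rw [Matrix.det_fin_two, hc] at hdet
  have hγ' : newformDedekindSumSL χ₂ χ₁ γ' =
      newformDedekindSumColumn χ₂ χ₁ (γ.1 1 1) (-(γ.1 0 1) * ((q₁ : ℤ) * (q₂ : ℤ))) := by
    rw [newformDedekindSumSL, newformDedekindSumColumn, h'c, h'a]
  lift r to ℕ using by omega
  have hr0 : 0 < r := by omega
  have hc' : (r : ℤ) * ((q₁ : ℤ) * (q₂ : ℤ)) = (q₂ * (r * q₁) : ℕ) := by push_cast; ring
  have hpos : 0 < q₂ * (r * q₁) := by positivity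
  have hγS : newformDedekindSumSL χ₁ χ₂ γ =
      newformDedekindSum χ₁ χ₂ (γ.1 0 0) (q₂ * (r * q₁) : ℕ) := by
    rw [newformDedekindSumSL, hc, hc', if_neg (by omega), if_pos (by omega)]
  rw [hγ', hγS]
  generalize γ.1 0 0 = a, γ.1 0 1 = b, γ.1 1 1 = d at *
  rcases lt_trichotomy a 0 with ha | rfl | ha
  · obtain ⟨a, rfl⟩ : ∃ k : ℕ, a = -k := ⟨(-a).toNat, by omega⟩
    obtain ⟨z, hz⟩ := newformDedekindSum_reciprocity_mod_two_of_pos h4₁ h4₂ hodd₁ hodd₂ hquad₁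
      hquad₂ hχ₁ hχ₂ hp₁ hp₂ hpar (a := a) (r := r) (by omega) hr0 (b := b) (d := -d)
      (by linear_combination hdet)
    rw [newformDedekindSum_neg_left hq₁ hquad₁ hquad₂, hz,
      newformDedekindSumColumn_neg_left hq₂ hquad₂ hquad₁]
    rcases apply_neg_one_eq_one_or_neg_one hquad₁ with h | h
    · refine ⟨-z, ?_⟩
      rw [h] at hpar ⊢
      push_cast
      linear_combination
        (newformDedekindSumColumn χ₂ χ₁ d (-b * ((q₁ : ℤ) * (q₂ : ℤ)))) * hpar
    · refine ⟨z, ?_⟩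
      rw [h] at hpar ⊢
      linear_combination
        (-newformDedekindSumColumn χ₂ χ₁ d (-b * ((q₁ : ℤ) * (q₂ : ℤ)))) * hpar
  · have hdvd : (q₁ : ℤ) ∣ 1 := ⟨-b * (r * q₂), by linear_combination -hdet⟩
    have := Int.eq_one_of_dvd_one (by omega) hdvd
    omega
  · lift a to ℕ using ha.le
    exact newformDedekindSum_reciprocity_mod_two_of_pos h4₁ h4₂ hodd₁ hodd₂ hquad₁
      hquad₂ hχ₁ hχ₂ hp₁ hp₂ hpar (by omega) hr0 (by linear_combination hdet)
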